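/- For every ε with 0 < ε ≤ 1 there exists a nonempty open interval I ⊆ (3/4, 1) such that for every q̃ ∈ I one has P(v₊²(q̃), ε) < 0; equivalently, for v = √(v₊²(q̃)) the matrix B^#(v, ε)⁻¹·A(v) has a pair of non-real complex-conjugate eigenvalues, so that the rest point ψ₊(q̃) of the profile equations is a stable spiraling focus. (Hence, for every sharply causal choice of the dissipation parameters, there is a range of Lax shocks whose dissipative shock profiles, if they exist, must be oscillatory.) -/

import Mathlib

/-- `v₊²(q̃) = ((2q̃ − 1) − √(q̃(4q̃ − 3)))/(4(1 − q̃))`. -/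
noncomputable def vplusSq (q : ℝ) : ℝ :=
  ((2 * q - 1) - Real.sqrt (q * (4 * q - 3))) / (4 * (1 - q))

/-- `v₋²(q̃) = ((2q̃ − 1) + √(q̃(4q̃ − 3)))/(4(1 − q̃))`. -/
noncomputable def vminusSq (q : ℝ) : ℝ :=
  ((2 * q - 1) + Real.sqrt (q * (4 * q - 3))) / (4 * (1 - q))

/-- `u = √(1 + v²)`. -/
noncomputable def uu (v : ℝ) : ℝ := Real.sqrt (1 + v ^ 2)

/-- The dissipation matrix `B^#(v, ε) = ε·B_visc − B₁ − (9ε/(4 − ε))·B₂`. -/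
noncomputable def Bsharp (v ε : ℝ) : Matrix (Fin 2) (Fin 2) ℝ :=
  ε • !![(uu v) ^ 2 * v ^ 2, -(uu v) ^ 3 * v; -(uu v) ^ 3 * v, (uu v) ^ 4]
    - !![16 * (uu v) ^ 2 * v ^ 2, -4 * (uu v) * v * (4 * v ^ 2 + 1);
         -4 * (uu v) * v * (4 * v ^ 2 + 1), (4 * v ^ 2 + 1) ^ 2]
    - (9 * ε / (4 - ε)) • !![((uu v) ^ 2 + v ^ 2) ^ 2, -2 * ((uu v) ^ 2 + v ^ 2) * (uu v) * v;
         -2 * ((uu v) ^ 2 + v ^ 2) * (uu v) * v, 4 * (uu v) ^ 2 * v ^ 2]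

/-- The matrix `A(v)` of the scaled linearization. -/
noncomputable def Amat (v : ℝ) : Matrix (Fin 2) (Fin 2) ℝ :=
  !![v * (6 * v ^ 2 + 5), -(uu v) * (6 * v ^ 2 + 1);
     -(uu v) * (6 * v ^ 2 + 1), 3 * v * (2 * v ^ 2 + 1)]

/-- The cubic polynomial `P(z, ε)`. -/
def Pcub (z ε : ℝ) : ℝ :=
  (ε ^ 4 + 16 * ε ^ 2 + 64) * z ^ 3
    + (2 * ε ^ 4 - 20 * ε ^ 3 - 24 * ε ^ 2 + 160 * ε - 64) * z ^ 2
    + (ε ^ 4 - 16 * ε ^ 3 + 84 * ε ^ 2 - 112 * ε + 16) * z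
    + ε * (4 * ε ^ 2 - 20 * ε + 16)

/-- A real `2 × 2` matrix with negative trace and negative discriminant has a pair of non-real
complex conjugate eigenvalues with negative real part. -/
lemma exists_conj_roots_of_discr_neg (M : Matrix (Fin 2) (Fin 2) ℝ) (ht : M.trace < 0)
    (hd : M.trace ^ 2 - 4 * M.det < 0) :
    ∃ μ : ℂ, μ.im ≠ 0 ∧ μ.re < 0 ∧ (M.map (algebraMap ℝ ℂ)).charpoly.IsRoot μ ∧
      (M.map (algebraMap ℝ ℂ)).charpoly.IsRoot (starRingEnd ℂ μ) := by
  have hs : 0 < 4 * M.det - M.trace ^ 2 := by linarith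
  have hsq := Real.sq_sqrt hs.le
  set s := Real.sqrt (4 * M.det - M.trace ^ 2)
  have hroot : ∀ μ : ℂ, μ.re = M.trace / 2 → μ.im ^ 2 = s ^ 2 / 4 →
      (M.map (algebraMap ℝ ℂ)).charpoly.IsRoot μ := by
    intro μ hre him
    have h1 : (M.map (algebraMap ℝ ℂ)).charpoly = M.charpoly.map (algebraMap ℝ ℂ) :=
      Matrix.charpoly_map M (algebraMap ℝ ℂ)
    rw [h1, Matrix.charpoly_fin_two, Polynomial.IsRoot]
    simp only [Polynomial.map_add, Polynomial.map_sub, Polynomial.map_mul, Polynomial.map_pow,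
      Polynomial.map_X, Polynomial.map_C, Polynomial.eval_add, Polynomial.eval_sub,
      Polynomial.eval_mul, Polynomial.eval_pow, Polynomial.eval_X, Polynomial.eval_C,
      Complex.coe_algebraMap]
    apply Complex.ext
    · simp [pow_two, hre]
      nlinarith
    · simp [pow_two, hre]
      ring
  refine ⟨⟨M.trace / 2, s / 2⟩, ?_, ?_, hroot _ rfl ?_, hroot _ rfl ?_⟩
  · exact (half_pos (Real.sqrt_pos.2 hs)).ne'
  · change M.trace / 2 < 0
    linarith
  · change (s / 2) ^ 2 = _
    ring
  · change (-(s / 2)) ^ 2 = _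
    ring

lemma uu_sq (v : ℝ) : uu v ^ 2 = 1 + v ^ 2 := Real.sq_sqrt (by positivity)

lemma det_Amat (v : ℝ) : (Amat v).det = 2 * v ^ 2 - 1 := by
  have hu := uu_sq v
  simp only [Amat, Matrix.det_fin_two_of]
  linear_combination (-(6 * v ^ 2 + 1) ^ 2) * hu

lemma det_Bsharp (v ε : ℝ) (hε : 4 - ε ≠ 0) :
    (Bsharp v ε).det = 9 * ε * ((1 - ε) - v ^ 2 * (8 + ε)) / (4 - ε) := by
  have hu := uu_sq v
  have hu4 : uu v ^ 4 = (1 + v ^ 2) ^ 2 := by rw [← hu]; ring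
  have hu6 : uu v ^ 6 = (1 + v ^ 2) ^ 3 := by rw [← hu]; ring
  have hu8 : uu v ^ 8 = (1 + v ^ 2) ^ 4 := by rw [← hu]; ring
  simp only [Bsharp, Matrix.det_fin_two, Matrix.sub_apply, Matrix.smul_apply, Matrix.of_apply,
    Matrix.cons_val', Matrix.cons_val_zero, Matrix.cons_val_one, smul_eq_mul,
    Matrix.cons_val_fin_one]
  field_simp
  ring_nf
  simp only [hu, hu4, hu6, hu8]
  ring

lemma trace_adjugate_Bsharp_mul_Amat (v ε : ℝ) (hε : 4 - ε ≠ 0) :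
    ((Bsharp v ε).adjugate * Amat v).trace =
      v * (12 + 18 * ε - 3 * ε ^ 2 - v ^ 2 * (24 + 3 * ε ^ 2)) / (4 - ε) := by
  have hu := uu_sq v
  have hu4 : uu v ^ 4 = (1 + v ^ 2) ^ 2 := by rw [← hu]; ring
  simp only [Bsharp, Amat, Matrix.adjugate_fin_two, Matrix.trace_fin_two, Matrix.mul_apply,
    Fin.sum_univ_two, Matrix.sub_apply, Matrix.smul_apply, Matrix.of_apply,
    Matrix.cons_val', Matrix.cons_val_zero, Matrix.cons_val_one, smul_eq_mul,
    Matrix.cons_val_fin_one]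
  field_simp
  ring_nf
  simp only [hu, hu4]
  ring

lemma discr_eq_Pcub (v ε : ℝ) (hε : 4 - ε ≠ 0) :
    ((Bsharp v ε).adjugate * Amat v).trace ^ 2 - 4 * ((Bsharp v ε).det * (Amat v).det) =
      9 * Pcub (v ^ 2) ε / (4 - ε) ^ 2 := by
  rw [trace_adjugate_Bsharp_mul_Amat v ε hε, det_Bsharp v ε hε, det_Amat, Pcub]
  field_simp
  ring

lemma spiraling_of_Pcub_neg {v ε : ℝ} (hv : 0 < v) (hv1 : 1 / 8 < v ^ 2) (hv2 : v ^ 2 < 1 / 2)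
    (hε0 : 0 < ε) (hε1 : ε ≤ 1) (hP : Pcub (v ^ 2) ε < 0) :
    ∃ μ : ℂ, μ.im ≠ 0 ∧ μ.re < 0 ∧
      (((Bsharp v ε)⁻¹ * Amat v).map (algebraMap ℝ ℂ)).charpoly.IsRoot μ ∧
      (((Bsharp v ε)⁻¹ * Amat v).map (algebraMap ℝ ℂ)).charpoly.IsRoot (starRingEnd ℂ μ) := by
  have h4 : 0 < 4 - ε := by linarith
  have hD : (Bsharp v ε).det < 0 := by
    rw [det_Bsharp v ε h4.ne']
    exact div_neg_of_neg_of_pos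
      (mul_neg_of_pos_of_neg (by linarith) (by nlinarith)) h4
  have hT : 0 < ((Bsharp v ε).adjugate * Amat v).trace := by
    rw [trace_adjugate_Bsharp_mul_Amat v ε h4.ne']
    exact div_pos (mul_pos hv (by nlinarith)) h4
  have htr : ((Bsharp v ε)⁻¹ * Amat v).trace =
      ((Bsharp v ε).adjugate * Amat v).trace / (Bsharp v ε).det := by
    rw [Matrix.inv_def, Ring.inverse_eq_inv', Matrix.smul_mul, Matrix.trace_smul, smul_eq_mul]
    ring
  have hdet : ((Bsharp v ε)⁻¹ * Amat v).det = (Amat v).det / (Bsharp v ε).det := by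
    rw [Matrix.det_mul, Matrix.det_nonsing_inv, Ring.inverse_eq_inv']
    ring
  apply exists_conj_roots_of_discr_neg
  · rw [htr]
    exact div_neg_of_pos_of_neg hT hD
  · have key : ((Bsharp v ε)⁻¹ * Amat v).trace ^ 2 - 4 * ((Bsharp v ε)⁻¹ * Amat v).det =
        9 * Pcub (v ^ 2) ε / (4 - ε) ^ 2 / (Bsharp v ε).det ^ 2 := by
      rw [htr, hdet, ← discr_eq_Pcub v ε h4.ne']
      have := hD.ne
      field_simp
    rw [key]
    exact div_neg_of_neg_of_pos (div_neg_of_neg_of_pos (by linarith) (by positivity))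
      (pow_pos (neg_pos.2 hD) 2 |>.trans_eq (neg_sq _))

/-- The function `vplusSq` is inverted by `z ↦ (4z + 1)² / (16z(1 + z))` on `(1/8, 1/2)`. -/
lemma vplusSq_inverse {z : ℝ} (h1 : 1 / 8 < z) (h2 : z < 1 / 2) :
    vplusSq ((4 * z + 1) ^ 2 / (16 * z * (1 + z))) = z := by
  have hz : 0 < z := by linarith
  have hz1 : 0 < 1 + z := by linarith
  have hz8 : 8 * z - 1 ≠ 0 := by linarith
  have hs : Real.sqrt ((4 * z + 1) ^ 2 / (16 * z * (1 + z)) *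
      (4 * ((4 * z + 1) ^ 2 / (16 * z * (1 + z))) - 3)) =
      (4 * z + 1) * (1 - 2 * z) / (8 * z * (1 + z)) := by
    rw [Real.sqrt_eq_iff_eq_sq]
    · field_simp
      ring
    · have : 4 * ((4 * z + 1) ^ 2 / (16 * z * (1 + z))) - 3 =
          (1 - 2 * z) ^ 2 / (4 * z * (1 + z)) := by
        field_simp
        ring
      rw [this]
      positivity
    · have : 0 < 1 - 2 * z := by linarith
      positivity
  have hden : 4 * (1 - (4 * z + 1) ^ 2 / (16 * z * (1 + z))) =
      (8 * z - 1) / (4 * z * (1 + z)) := by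
    field_simp
    ring
  have hnum : 2 * ((4 * z + 1) ^ 2 / (16 * z * (1 + z))) - 1 -
      (4 * z + 1) * (1 - 2 * z) / (8 * z * (1 + z)) =
      z * ((8 * z - 1) / (4 * z * (1 + z))) := by
    field_simp
    ring
  rw [vplusSq, hs, hden, hnum]
  exact mul_div_cancel_right₀ _ (by positivity)

lemma continuousAt_vplusSq {q : ℝ} (hq : q < 1) : ContinuousAt vplusSq q := by
  unfold vplusSq
  have : 4 * (1 - q) ≠ 0 := by linarith
  fun_prop (disch := assumption)

lemma Pcub_neg_at {ε : ℝ} (hε0 : 0 < ε) (hε1 : ε ≤ 1) :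
    Pcub ((4 - ε) / (8 + 10 * ε)) ε < 0 := by
  have hd : 0 < 8 + 10 * ε := by linarith
  have key : Pcub ((4 - ε) / (8 + 10 * ε)) ε =
      ε ^ 5 * (-20736 + 5508 * ε - 81 * ε ^ 2) / (8 + 10 * ε) ^ 3 := by
    unfold Pcub
    field_simp
    ring
  rw [key]
  exact div_neg_of_neg_of_pos
    (mul_neg_of_pos_of_neg (by positivity) (by nlinarith)) (by positivity)

/-- For every sharply causal choice `0 < ε ≤ 1` there is a nonempty open interval
`I ⊆ (3/4, 1)` of shock parameters such that for all `q̃ ∈ I` one has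
`P(v₊²(q̃), ε) < 0`; equivalently, for `v = √(v₊²(q̃))` the matrix `B^#(v, ε)⁻¹·A(v)`
has a pair of non-real complex-conjugate eigenvalues with negative real part, so
`ψ₊(q̃)` is a stable spiraling focus and any dissipative shock profile is oscillatory. -/
theorem oscillatory_range (ε : ℝ) (hε0 : 0 < ε) (hε1 : ε ≤ 1) :
    ∃ a b : ℝ, 3 / 4 ≤ a ∧ a < b ∧ b ≤ 1 ∧ ∀ q ∈ Set.Ioo a b,
      Pcub (vplusSq q) ε < 0 ∧
      ∃ μ : ℂ, μ.im ≠ 0 ∧ μ.re < 0 ∧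
        (Matrix.charpoly
          (((Bsharp (Real.sqrt (vplusSq q)) ε)⁻¹ * Amat (Real.sqrt (vplusSq q))).map
            (algebraMap ℝ ℂ))).IsRoot μ ∧
        (Matrix.charpoly
          (((Bsharp (Real.sqrt (vplusSq q)) ε)⁻¹ * Amat (Real.sqrt (vplusSq q))).map
            (algebraMap ℝ ℂ))).IsRoot (starRingEnd ℂ μ) := by
  have hd : 0 < 8 + 10 * ε := by linarith
  obtain ⟨z, hz⟩ : ∃ z, z = (4 - ε) / (8 + 10 * ε) := ⟨_, rfl⟩
  have hz1 : 1 / 8 < z := by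
    rw [hz, lt_div_iff₀ hd]
    linarith
  have hz2 : z < 1 / 2 := by
    rw [hz, div_lt_iff₀ hd]
    linarith
  have hzP : Pcub z ε < 0 := hz ▸ Pcub_neg_at hε0 hε1
  obtain ⟨q₀, hq₀⟩ : ∃ q₀, q₀ = (4 * z + 1) ^ 2 / (16 * z * (1 + z)) := ⟨_, rfl⟩
  have hpos : 0 < 16 * z * (1 + z) := by nlinarith
  have hq1 : 3 / 4 < q₀ := by
    rw [hq₀, lt_div_iff₀ hpos]
    nlinarith [mul_pos (sub_pos.2 hz2) (sub_pos.2 hz2)]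
  have hq2 : q₀ < 1 := by
    rw [hq₀, div_lt_iff₀ hpos]
    nlinarith
  have hvq : vplusSq q₀ = z := hq₀ ▸ vplusSq_inverse hz1 hz2
  have hc : Filter.Tendsto vplusSq (nhds q₀) (nhds z) := hvq ▸ continuousAt_vplusSq hq2
  have hPc : Continuous fun z => Pcub z ε := by
    unfold Pcub
    fun_prop
  have hnhds : ∀ᶠ q in nhds q₀, (3 / 4 < q ∧ q < 1) ∧
      (1 / 8 < vplusSq q ∧ vplusSq q < 1 / 2) ∧ Pcub (vplusSq q) ε < 0 :=
    ((lt_mem_nhds hq1).and (gt_mem_nhds hq2)).and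
      (((hc.eventually (lt_mem_nhds hz1)).and (hc.eventually (gt_mem_nhds hz2))).and
        (hc.eventually (hPc.continuousAt.eventually (gt_mem_nhds hzP))))
  obtain ⟨a, b, hab, hsub⟩ := mem_nhds_iff_exists_Ioo_subset.1 hnhds
  have hlt : a < b := hab.1.trans hab.2
  refine ⟨max a (3 / 4), min b 1, le_max_right _ _, ?_, min_le_right _ _, fun q hq => ?_⟩
  · exact (max_lt hab.1 hq1).trans (lt_min hab.2 hq2)
  · obtain ⟨-, ⟨hv1, hv2⟩, hP⟩ :=
      hsub ⟨(le_max_left _ _).trans_lt hq.1, hq.2.trans_le (min_le_left _ _)⟩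
    have hv0 : 0 < vplusSq q := by linarith
    have hsq : Real.sqrt (vplusSq q) ^ 2 = vplusSq q := Real.sq_sqrt hv0.le
    refine ⟨hP, spiraling_of_Pcub_neg (Real.sqrt_pos.2 hv0) ?_ ?_ hε0 hε1 ?_⟩ <;> rwa [hsq]
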